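/- Let P be an N×N real symmetric, irreducible column-stochastic matrix with orthonormal eigenbasis {φ_k} and eigenvalues {λ_k}, and let Π(y,x) := Σ_j |Σ_{k∈C_j} φ_k(y) φ_k(x)|², where {C_j} is the partition of indices grouping together indices with identical eigenvalue. Then Π is a column-stochastic matrix and every entry satisfies Π(y,x) ≥ 1/N²; in particular Π is ergodic. -/

import Mathlib

open Matrix Finset

/-- Column-stochastic matrix: nonnegative entries, each column sums to 1. -/
def IsColStochastic {N : ℕ} (P : Matrix (Fin N) (Fin N) ℝ) : Prop :=
  (∀ y x, 0 ≤ P y x) ∧ ∀ x, ∑ y, P y x = 1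

/-- Irreducibility: every state reaches every state in some positive number of steps. -/
def MarkovIrreducible {N : ℕ} (P : Matrix (Fin N) (Fin N) ℝ) : Prop :=
  ∀ x y, ∃ m : ℕ, 0 < m ∧ 0 < (P ^ m) y x

/-- The limiting matrix `Π(y,x) = Σ_j |Σ_{k ∈ C_j} φ_k(y) φ_k(x)|²`, where the
indices `k` are grouped into classes `C_j` of identical eigenvalue. -/
noncomputable def limitPi {N : ℕ} (φ : Fin N → Fin N → ℝ) (lam : Fin N → ℝ) :
    Matrix (Fin N) (Fin N) ℝ :=
  Matrix.of fun y x => ∑ μ ∈ Finset.univ.image lam,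
    (∑ k ∈ Finset.univ.filter fun k => lam k = μ, φ k y * φ k x) ^ 2

lemma Matrix.pow_mulVec_eq_self {n R : Type*} [Fintype n] [DecidableEq n] [Semiring R]
    {P : Matrix n n R} {v : n → R} (h : P *ᵥ v = v) (m : ℕ) : (P ^ m) *ᵥ v = v := by
  induction m with
  | zero => simp
  | succ m ih => rw [pow_succ, ← Matrix.mulVec_mulVec, h, ih]

lemma Matrix.pow_apply_nonneg_of_nonneg {n : Type*} [Fintype n] [DecidableEq n]
    {P : Matrix n n ℝ} (h : ∀ y x, 0 ≤ P y x) (m : ℕ) (y x : n) : 0 ≤ (P ^ m) y x := by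
  induction m generalizing y x with
  | zero => rw [pow_zero, Matrix.one_apply]; split_ifs <;> norm_num
  | succ m ih =>
    rw [pow_succ, Matrix.mul_apply]
    exact Finset.sum_nonneg fun s _ => mul_nonneg (ih y s) (h s x)

/-- Maximum principle: a harmonic function of an irreducible row-stochastic matrix is constant. -/
lemma MarkovIrreducible.eq_of_mulVec_eq_self {N : ℕ} {P : Matrix (Fin N) (Fin N) ℝ}
    (hirr : MarkovIrreducible P) (hnn : ∀ y x, 0 ≤ P y x) (hrow : P *ᵥ 1 = 1)
    {v : Fin N → ℝ} (hv : P *ᵥ v = v) (x y : Fin N) : v x = v y := by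
  have : Nonempty (Fin N) := ⟨x⟩
  obtain ⟨z, hz⟩ := Finite.exists_max v
  have key : ∀ s, v s = v z := by
    intro s
    obtain ⟨m, -, hm⟩ := hirr s z
    have h1 := congrFun (Matrix.pow_mulVec_eq_self hrow m) z
    have h2 := congrFun (Matrix.pow_mulVec_eq_self hv m) z
    simp only [Matrix.mulVec, dotProduct, Pi.one_apply, mul_one] at h1 h2
    have h3 : ∑ t, (P ^ m) z t * (v z - v t) = 0 := by
      simp only [mul_sub, Finset.sum_sub_distrib, ← Finset.sum_mul, h1, h2, one_mul, sub_self]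
    have h4 := (Finset.sum_eq_zero_iff_of_nonneg fun t _ =>
      mul_nonneg (Matrix.pow_apply_nonneg_of_nonneg hnn m z t) (sub_nonneg.2 (hz t))).1 h3 s
      (Finset.mem_univ s)
    rcases mul_eq_zero.1 h4 with h | h
    · exact absurd h hm.ne'
    · linarith
  rw [key x, key y]

lemma sum_mul_eq_ite_of_orthonormal {n : Type*} [Fintype n] [DecidableEq n] {φ : n → n → ℝ}
    (hortho : ∀ k l, ∑ s, φ k s * φ l s = if k = l then (1 : ℝ) else 0) (y x : n) :
    ∑ k, φ k y * φ k x = if y = x then (1 : ℝ) else 0 := by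
  have h : Matrix.of φ * (Matrix.of φ)ᵀ = 1 := by
    ext k l
    simpa [Matrix.mul_apply, Matrix.one_apply] using hortho k l
  have h' := congrArg (fun M : Matrix n n ℝ => M y x) (mul_eq_one_comm.1 h)
  simpa [Matrix.mul_apply, Matrix.one_apply] using h'

lemma isColStochastic_limitPi {N : ℕ} {φ : Fin N → Fin N → ℝ} (lam : Fin N → ℝ)
    (hortho : ∀ k l, ∑ s, φ k s * φ l s = if k = l then (1 : ℝ) else 0) :
    IsColStochastic (limitPi φ lam) := by
  refine ⟨fun y x => by rw [limitPi, Matrix.of_apply]; positivity, fun x => ?_⟩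
  have hproj : ∀ S : Finset (Fin N),
      ∑ y, (∑ k ∈ S, φ k y * φ k x) ^ 2 = ∑ k ∈ S, φ k x * φ k x := by
    intro S
    calc ∑ y, (∑ k ∈ S, φ k y * φ k x) ^ 2
        = ∑ y, ∑ k ∈ S, ∑ l ∈ S, φ k x * φ l x * (φ k y * φ l y) := by
          simp only [sq, Finset.sum_mul_sum]
          exact Finset.sum_congr rfl fun y _ => Finset.sum_congr rfl fun k _ =>
            Finset.sum_congr rfl fun l _ => by ring
      _ = ∑ k ∈ S, ∑ l ∈ S, φ k x * φ l x * ∑ y, φ k y * φ l y := by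
          rw [Finset.sum_comm]
          refine Finset.sum_congr rfl fun k _ => ?_
          rw [Finset.sum_comm]
          simp only [Finset.mul_sum]
      _ = ∑ k ∈ S, φ k x * φ k x := by
          refine Finset.sum_congr rfl fun k hk => ?_
          simp [hortho, hk]
  simp only [limitPi, Matrix.of_apply]
  rw [Finset.sum_comm]
  simp only [hproj]
  rw [Finset.sum_fiberwise_of_maps_to fun k hk => Finset.mem_image_of_mem lam hk]
  simp [sum_mul_eq_ite_of_orthonormal hortho]

lemma IsColStochastic.exists_eigenvalue_eq_one {N : ℕ} [NeZero N] {P : Matrix (Fin N) (Fin N) ℝ}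
    (hP : IsColStochastic P) {φ : Fin N → Fin N → ℝ} {lam : Fin N → ℝ}
    (hortho : ∀ k l, ∑ s, φ k s * φ l s = if k = l then (1 : ℝ) else 0)
    (heig : ∀ k, P *ᵥ φ k = lam k • φ k) : ∃ k, lam k = 1 := by
  by_contra! hne
  have hzero : ∀ k, ∑ s, φ k s = 0 := by
    intro k
    have h : ∑ y, (P *ᵥ φ k) y = ∑ s, φ k s := by
      simp only [Matrix.mulVec, dotProduct]
      rw [Finset.sum_comm]
      simp only [← Finset.sum_mul, hP.2, one_mul]
    simp only [heig, Pi.smul_apply, smul_eq_mul, ← Finset.mul_sum] at h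
    have h' : (lam k - 1) * ∑ s, φ k s = 0 := by linarith
    exact (mul_eq_zero.1 h').resolve_left (sub_ne_zero.2 (hne k))
  have h : ∑ y : Fin N, ∑ k, φ k y * φ k 0 = 1 := by
    simp [sum_mul_eq_ite_of_orthonormal hortho]
  rw [Finset.sum_comm] at h
  simp [← Finset.sum_mul, hzero] at h

lemma one_div_sq_le_limitPi {N : ℕ} {P : Matrix (Fin N) (Fin N) ℝ}
    (hP : IsColStochastic P) (hsymm : P.IsSymm) (hirr : MarkovIrreducible P)
    {φ : Fin N → Fin N → ℝ} {lam : Fin N → ℝ}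
    (hortho : ∀ k l, ∑ s, φ k s * φ l s = if k = l then (1 : ℝ) else 0)
    (heig : ∀ k, P *ᵥ φ k = lam k • φ k) (y x : Fin N) :
    1 / (N : ℝ) ^ 2 ≤ limitPi φ lam y x := by
  have : NeZero N := ⟨by rintro rfl; exact y.elim0⟩
  have hN : (N : ℝ) ≠ 0 := Nat.cast_ne_zero.2 (NeZero.ne N)
  have hrow : P *ᵥ 1 = 1 := by
    ext z
    simp only [Matrix.mulVec, dotProduct, Pi.one_apply, mul_one]
    rw [← hP.2 z]
    exact Finset.sum_congr rfl fun s _ => hsymm.apply s z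
  have hval : ∀ k, lam k = 1 → φ k y * φ k x = 1 / N := by
    intro k hk
    have hconst := hirr.eq_of_mulVec_eq_self hP.1 hrow (v := φ k) (by rw [heig, hk, one_smul])
    have hnorm := hortho k k
    simp only [hconst _ x, Finset.sum_const, Finset.card_univ, Fintype.card_fin, if_true,
      nsmul_eq_mul] at hnorm
    rw [hconst y x, eq_div_iff hN, mul_comm, hnorm]
  obtain ⟨k₀, hk₀⟩ := hP.exists_eigenvalue_eq_one hortho heig
  have hone : 1 / (N : ℝ) ≤ ∑ k ∈ Finset.univ.filter (fun k => lam k = 1), φ k y * φ k x := by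
    rw [← hval k₀ hk₀]
    refine Finset.single_le_sum (f := fun k => φ k y * φ k x) (fun k hk => ?_) (by simp [hk₀])
    rw [hval k (Finset.mem_filter.1 hk).2]
    positivity
  calc 1 / (N : ℝ) ^ 2 = (1 / (N : ℝ)) ^ 2 := by rw [div_pow, one_pow]
    _ ≤ (∑ k ∈ Finset.univ.filter (fun k => lam k = 1), φ k y * φ k x) ^ 2 := by gcongr
    _ ≤ limitPi φ lam y x :=
      Finset.single_le_sum
        (f := fun μ => (∑ k ∈ Finset.univ.filter (fun k => lam k = μ), φ k y * φ k x) ^ 2)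
        (fun μ _ => sq_nonneg _) (Finset.mem_image.2 ⟨k₀, Finset.mem_univ _, hk₀⟩)

/-- For a symmetric irreducible stochastic `P` with orthonormal eigenbasis `{φ_k}`,
the matrix `Π` is column-stochastic with every entry at least `1/N²`;
in particular `Π` is ergodic. -/
theorem limitPi_stochastic_entry_lb_ergodic {N : ℕ} (P : Matrix (Fin N) (Fin N) ℝ)
    (hP : IsColStochastic P) (hsymm : P.IsSymm) (hirr : MarkovIrreducible P)
    (φ : Fin N → Fin N → ℝ) (lam : Fin N → ℝ)
    (hortho : ∀ k l, ∑ s, φ k s * φ l s = if k = l then (1 : ℝ) else 0)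
    (heig : ∀ k, P.mulVec (φ k) = lam k • φ k) :
    IsColStochastic (limitPi φ lam) ∧
      (∀ y x, 1 / (N : ℝ) ^ 2 ≤ limitPi φ lam y x) ∧
      (∃ m : ℕ, 0 < m ∧ ∀ y x, 0 < ((limitPi φ lam) ^ m) y x) := by
  have hlb := one_div_sq_le_limitPi hP hsymm hirr hortho heig
  refine ⟨isColStochastic_limitPi lam hortho, hlb, 1, one_pos, fun y x => ?_⟩
  have hN : (0 : ℝ) < N := Nat.cast_pos.2 y.pos
  rw [pow_one]
  exact lt_of_lt_of_le (by positivity) (hlb y x)
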